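/- arXiv:2512.17314 — 2 statements merged into one kernel-verified Lean document; each statement's English description precedes it below -/
import Mathlib

section
/- Let (X,τ,≤) be a compact Hausdorff space where ≤ is a linear order whose graph is closed in X × X. Then τ equals the interval topology of ≤. -/
/-- If `(X,τ,≤)` is a compact Hausdorff space with a linear order whose graph
is closed in `X × X`, then `τ` is the interval topology of `≤`. -/
theorem stmt7 {X : Type*} [TopologicalSpace X] [CompactSpace X] [T2Space X]
    [LinearOrder X] (hcl : IsClosed {p : X × X | p.1 ≤ p.2}) :
    OrderTopology X := by
  rename_i τ hc ht lo
  haveI : OrderClosedTopology X := ⟨hcl⟩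
  have hle : τ ≤ Preorder.topology X := by
    refine le_generateFrom ?_
    rintro s ⟨a, rfl | rfl⟩
    · exact isOpen_Ioi
    · exact isOpen_Iio
  have hT2 : @T2Space X (Preorder.topology X) := by
    letI : TopologicalSpace X := Preorder.topology X
    haveI : OrderTopology X := ⟨rfl⟩
    infer_instance
  refine ⟨le_antisymm hle ?_⟩
  have hcont : @Continuous X X τ (Preorder.topology X) id := continuous_id_iff_le.2 hle
  have hcm : @IsClosedMap X X τ (Preorder.topology X) id :=
    @Continuous.isClosedMap X X τ (Preorder.topology X) hc hT2 id hcont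
  intro s hs
  have h := hcm sᶜ (isClosed_compl_iff.2 hs)
  rw [Set.image_id] at h
  exact (@isClosed_compl_iff X (Preorder.topology X) s).1 h
end

section
/- Let p : X → Y be a map between circularly ordered sets satisfying: for every [a,b,c] in X with f(a), f(b), f(c) pairwise distinct, [f(a),f(b),f(c)] holds in Y (condition COP1). If the image p(X) has at least 3 elements, then p also satisfies condition COP2: whenever p(a) = p(c), p is constant on one of the closed intervals [a,c], [c,a]. -/
/-- If a map `p` between circularly ordered sets satisfies (COP1) and its image
has at least 3 elements, then it satisfies (COP2): whenever `p a = p c`, the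
map `p` is constant on one of the closed intervals `[a,c]`, `[c,a]`. -/
theorem stmt16 {X Y : Type*} (RX : X → X → X → Prop) (RY : Y → Y → Y → Prop)
    (cycX : ∀ a b c, RX a b c → RX b c a)
    (asymX : ∀ a b c, RX a b c → ¬ RX c b a)
    (transX : ∀ a b c d, RX a b c → RX a c d → RX a b d)
    (totalX : ∀ a b c : X, a ≠ b → b ≠ c → a ≠ c → RX a b c ∨ RX a c b)
    (cycY : ∀ a b c, RY a b c → RY b c a)
    (asymY : ∀ a b c, RY a b c → ¬ RY c b a)
    (transY : ∀ a b c d, RY a b c → RY a c d → RY a b d)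
    (totalY : ∀ a b c : Y, a ≠ b → b ≠ c → a ≠ c → RY a b c ∨ RY a c b)
    (p : X → Y)
    (hCOP1 : ∀ a b c, RX a b c → p a ≠ p b → p b ≠ p c → p a ≠ p c →
      RY (p a) (p b) (p c))
    (h3 : ∃ x₁ x₂ x₃ : X, p x₁ ≠ p x₂ ∧ p x₂ ≠ p x₃ ∧ p x₁ ≠ p x₃) :
    ∀ a c : X, p a = p c →
      (∀ x ∈ ({y | RX a y c} ∪ {a, c} : Set X), p x = p a) ∨
      (∀ x ∈ ({y | RX c y a} ∪ {c, a} : Set X), p x = p a) := by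
  intro a c hac
  have key : ∀ x y, RX a x c → RX c y a → p x ≠ p a → p y ≠ p a → p x = p y := by
    intro x y hx hy hxa hya
    by_contra hne
    have h1 : RX a x y := transX a x c y hx (cycX _ _ _ (cycX _ _ _ hy))
    have h2 : RX x c y :=
      cycX _ _ _ (cycX _ _ _ (transX c y a x hy (cycX _ _ _ (cycX _ _ _ hx))))
    have h3 := hCOP1 a x y h1 (Ne.symm hxa) hne (Ne.symm hya)
    have h4 := hCOP1 x c y h2 (hac ▸ hxa) (hac ▸ Ne.symm hya) hne
    rw [← hac] at h4
    exact asymY _ _ _ h3 (cycY _ _ _ (cycY _ _ _ h4))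
  by_contra hcon
  rw [not_or] at hcon
  obtain ⟨hn1, hn2⟩ := hcon
  push Not at hn1 hn2
  obtain ⟨x, hx, hxa⟩ := hn1
  obtain ⟨y, hy, hya⟩ := hn2
  have hx' : RX a x c := by
    rcases hx with h | h | h
    · exact h
    · exact absurd (by rw [h]) hxa
    · exact absurd (by rw [h, hac]) hxa
  have hy' : RX c y a := by
    rcases hy with h | h | h
    · exact h
    · exact absurd (by rw [h, hac]) hya
    · exact absurd (by rw [h]) hya
  have hxy := key x y hx' hy' hxa hya
  have hne : a ≠ c := by
    rintro rfl
    exact asymX _ _ _ hx' hx'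
  have two : ∀ z, p z = p a ∨ p z = p x := by
    intro z
    by_cases hz : p z = p a
    · exact Or.inl hz
    · right
      have hza : a ≠ z := by rintro rfl; exact hz rfl
      have hzc : z ≠ c := by rintro rfl; exact hz hac.symm
      rcases totalX a z c hza hzc hne with h | h
      · rw [hxy]; exact key z y h hy' hz hya
      · exact (key x z hx' (cycX _ _ _ h) hxa hz).symm
  obtain ⟨u, v, w, huv, hvw, huw⟩ := h3
  have hu := two u
  have hv := two v
  have hw := two w
  grind
end
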